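/- Let V be an n-dimensional real normed space. Every sequence (y_m) in V admits a subsequence which either converges, or is flag-directed: there exist 1 ≤ p ≤ n, linearly independent vectors v₁,…,v_p ∈ V, a subspace W complementary to span{v₁,…,v_p}, functions f₁,…,f_p : ℕ → ℝ with f_i(k) → +∞ for each i and f_{i+1}(k)/f_i(k) → 0 for each 1 ≤ i ≤ p−1, and a convergent sequence g : ℕ → W, such that the subsequence equals k ↦ Σ_{i=1}^p f_i(k)·v_i + g(k). -/

import Mathlib

open Filter

/-- A sequence in a subspace `S` of a finite-dimensional normed space has a subsequence whose
coordinates along a finite biorthogonal system `(v i, φ i)`, `i < p`, with `v i ∈ S`, tend to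
infinity at strictly decreasing rates, and whose remaining component converges. -/
theorem exists_subsequence_biorthogonal_expansion {V : Type*} [NormedAddCommGroup V]
    [NormedSpace ℝ V] [FiniteDimensional ℝ V] (S : Submodule ℝ V) (y : ℕ → V)
    (hy : ∀ k, y k ∈ S) :
    ∃ σ : ℕ → ℕ, StrictMono σ ∧ ∃ (p : ℕ) (v : ℕ → V) (φ : ℕ → V →L[ℝ] ℝ),
      (∀ i < p, v i ∈ S) ∧
      (∀ i < p, ∀ j < p, φ i (v j) = if i = j then 1 else 0) ∧
      (∀ i < p, Tendsto (fun k => φ i (y (σ k))) atTop atTop) ∧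
      (∀ i, i + 1 < p →
        Tendsto (fun k => φ (i + 1) (y (σ k)) / φ i (y (σ k))) atTop (nhds 0)) ∧
      ∃ g₀ : V, Tendsto (fun k => y (σ k) - ∑ i ∈ Finset.range p, φ i (y (σ k)) • v i)
        atTop (nhds g₀) := by
  induction S using WellFoundedLT.induction generalizing y with
  | ind S ih =>
  by_cases hlim : Tendsto (fun k => ‖y k‖) atTop atTop
  swap
  · obtain ⟨b, hb⟩ : ∃ b, ∃ᶠ k in atTop, ‖y k‖ < b := by
      simpa only [tendsto_atTop, not_forall, not_eventually, not_le] using hlim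
    obtain ⟨a, -, σ, hσ, ha⟩ := tendsto_subseq_of_frequently_bounded
      (Metric.isBounded_ball (x := (0 : V)) (r := b)) (x := y) (by simpa using hb)
    exact ⟨σ, hσ, 0, 0, 0, by simp, by simp, by simp, by simp, a,
      by simpa [Function.comp_def] using ha⟩
  obtain ⟨u, -, τ, hτ, hu⟩ := tendsto_subseq_of_bounded
    (Metric.isBounded_closedBall (x := (0 : V)) (r := 1)) (x := fun k => ‖y k‖⁻¹ • y k)
    (fun k => by
      simpa [norm_smul] using inv_mul_le_one (a := ‖y k‖))
  have hlim' : Tendsto (fun k => ‖y (τ k)‖) atTop atTop := hlim.comp hτ.tendsto_atTop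
  have hpos : ∀ᶠ k in atTop, 0 < ‖y (τ k)‖ := hlim'.eventually_gt_atTop 0
  have huS : u ∈ S := S.closed_of_finiteDimensional.mem_of_tendsto hu
    (Eventually.of_forall fun k => S.smul_mem _ (hy _))
  have hu0 : u ≠ 0 := by
    have h1 : Tendsto (fun k => ‖‖y (τ k)‖⁻¹ • y (τ k)‖) atTop (nhds 1) :=
      tendsto_const_nhds.congr' (hpos.mono fun k hk => by
        dsimp only
        rw [norm_smul, norm_inv, norm_norm, inv_mul_cancel₀ hk.ne'])
    have h2 : ‖u‖ = 1 := tendsto_nhds_unique hu.norm h1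
    exact norm_ne_zero_iff.mp (by simp [h2])
  obtain ⟨ψ, hψ⟩ := SeparatingDual.exists_eq_one (R := ℝ) hu0
  have hψu : Tendsto (fun k => ψ (‖y (τ k)‖⁻¹ • y (τ k))) atTop (nhds 1) :=
    hψ ▸ (ψ.continuous.tendsto u).comp hu
  let q : V →L[ℝ] V := ContinuousLinearMap.id ℝ V - ψ.smulRight u
  have hq (x : V) : q x = x - ψ x • u := by simp [q]
  have hqu : q u = 0 := by simp [hq, hψ]
  have hlt : S ⊓ ψ.ker < S := inf_le_left.lt_of_ne fun h => by
    simpa [hψ] using (h.ge huS).2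
  obtain ⟨σ, hσ, p, v, φ, hvS, hφv, hφ, hφr, g₀, hg⟩ := ih _ hlt (fun k => q (y (τ k)))
    (fun k => ⟨hq (y (τ k)) ▸ S.sub_mem (hy _) (S.smul_mem _ huS), by simp [hq, hψ]⟩)
  have hψv : ∀ i < p, ψ (v i) = 0 := fun i hi => by simpa using (hvS i hi).2
  have hqv : ∀ i < p, q (v i) = v i := fun i hi => by simp [hq, hψv i hi]
  refine ⟨τ ∘ σ, hτ.comp hσ, p + 1, fun | 0 => u | i + 1 => v i,
    fun | 0 => ψ | i + 1 => (φ i).comp q, ?_, ?_, ?_, ?_, g₀, ?_⟩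
  · rintro (_ | i) hi
    · exact huS
    · exact (hvS i (by omega)).1
  · rintro (_ | i) hi (_ | j) hj
    · simpa using hψ
    · simpa using hψv j (by omega)
    · simp [hqu]
    · simpa [hqv j (by omega)] using hφv i (by omega) j (by omega)
  · rintro (_ | i) hi
    · have h : Tendsto (fun k => ψ (y (τ k))) atTop atTop := by
        refine (hlim'.atTop_mul_pos one_pos hψu).congr' ?_
        filter_upwards [hpos] with k hk
        simp [hk.ne']
      exact h.comp hσ.tendsto_atTop
    · exact hφ i (by omega)
  · rintro (_ | i) hi
    · have h0 : Tendsto (fun k => φ 0 (q (‖y (τ k)‖⁻¹ • y (τ k)))) atTop (nhds 0) := by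
        have := (((φ 0).comp q).continuous.tendsto u).comp hu
        rwa [ContinuousLinearMap.comp_apply, hqu, map_zero] at this
      have h : Tendsto (fun k => φ 0 (q (y (τ k))) / ψ (y (τ k))) atTop (nhds 0) := by
        refine (zero_div (1 : ℝ) ▸ h0.div hψu one_ne_zero).congr' ?_
        filter_upwards [hpos] with k hk
        simp only [Pi.div_apply, map_smul, smul_eq_mul]
        exact mul_div_mul_left _ _ (inv_ne_zero hk.ne')
      exact h.comp hσ.tendsto_atTop
    · exact hφr i (by omega)
  · refine hg.congr fun k => ?_
    rw [Finset.sum_range_succ']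
    simp only [Function.comp_apply, ContinuousLinearMap.comp_apply]
    nth_rw 1 [hq]
    abel

/-- Every sequence in an `n`-dimensional real normed space admits a subsequence which
either converges or is flag-directed of some level `1 ≤ p ≤ n`. -/
theorem exists_convergent_or_flag_directed_subsequence {V : Type*} [NormedAddCommGroup V]
    [NormedSpace ℝ V] [FiniteDimensional ℝ V] (n : ℕ)
    (hn : Module.finrank ℝ V = n) (y : ℕ → V) :
    ∃ σ : ℕ → ℕ, StrictMono σ ∧
      ((∃ L : V, Tendsto (fun k => y (σ k)) atTop (nhds L)) ∨
        ∃ p : ℕ, 1 ≤ p ∧ p ≤ n ∧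
          ∃ v : ℕ → V, LinearIndependent ℝ (fun i : Fin p => v i) ∧
            ∃ W : Submodule ℝ V, IsCompl (Submodule.span ℝ (v '' Set.Iio p)) W ∧
              ∃ f : ℕ → ℕ → ℝ,
                (∀ i < p, Tendsto (fun k => f i k) atTop atTop) ∧
                (∀ i, i + 1 < p →
                  Tendsto (fun k => f (i + 1) k / f i k) atTop (nhds 0)) ∧
                ∃ g : ℕ → V, (∀ k, g k ∈ W) ∧
                  (∃ g₀ : V, Tendsto g atTop (nhds g₀)) ∧
                  ∀ k, y (σ k) = (∑ i ∈ Finset.range p, f i k • v i) + g k) := by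
  obtain ⟨σ, hσ, p, v, φ, -, hφv, hφ, hφr, g₀, hg⟩ :=
    exists_subsequence_biorthogonal_expansion ⊤ y fun _ => Submodule.mem_top
  refine ⟨σ, hσ, ?_⟩
  obtain rfl | hp := Nat.eq_zero_or_pos p
  · exact Or.inl ⟨g₀, by simpa using hg⟩
  have hv : LinearIndependent ℝ (fun i : Fin p => v i) :=
    LinearIndependent.of_pairwise_dual_eq_zero_one _ (fun i : Fin p => (φ i : V →ₗ[ℝ] ℝ))
      (fun i j hij => by simp [hφv i i.2 j j.2, Fin.val_ne_of_ne hij])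
      (fun i => by simp [hφv i i.2 i i.2])
  let P : V →ₗ[ℝ] V := ∑ i ∈ Finset.range p, (φ i : V →ₗ[ℝ] ℝ).smulRight (v i)
  have hP (x : V) : P x = ∑ i ∈ Finset.range p, φ i x • v i := by simp [P]
  have hPmem (x : V) : P x ∈ Submodule.span ℝ (v '' Set.Iio p) := by
    rw [hP]
    exact Submodule.sum_mem _ fun i hi => Submodule.smul_mem _ _
      (Submodule.subset_span ⟨i, Finset.mem_range.mp hi, rfl⟩)
  have hPid : Set.EqOn P (LinearMap.id : V →ₗ[ℝ] V) (Submodule.span ℝ (v '' Set.Iio p)) := by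
    refine LinearMap.eqOn_span (g := LinearMap.id) ?_
    rintro _ ⟨j, hj, rfl⟩
    rw [hP, Finset.sum_eq_single j]
    · simp [hφv j hj j hj]
    · intro i hi hij
      simp [hφv i (Finset.mem_range.mp hi) j hj, hij]
    · exact fun h => absurd (Finset.mem_range.mpr hj) h
  have hPker (x : V) : x - P x ∈ P.ker := by
    simpa [sub_eq_zero] using (hPid (hPmem x)).symm
  refine Or.inr ⟨p, hp, by simpa [hn] using hv.fintype_card_le_finrank, v, hv, P.ker,
    ⟨?_, ?_⟩, fun i k => φ i (y (σ k)), hφ, hφr, fun k => y (σ k) - P (y (σ k)),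
    fun k => hPker _, ⟨g₀, by simpa only [hP] using hg⟩, fun k => by simp [hP]⟩
  · rw [Submodule.disjoint_def]
    intro x hx hx0
    exact (hPid hx).symm.trans hx0
  · rw [Submodule.codisjoint_iff_exists_add_eq]
    exact fun x => ⟨P x, x - P x, hPmem x, hPker x, add_sub_cancel _ _⟩
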